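/- Let $r \in \mathbb{N}$ be even and $1 < p < \infty$. For any cubature formula $(\xi, \Lambda)$ with $m \ge 2$ knots in $[0,1)^d$, the averaged-in-$\mathbf{u}$ error function $f(\mathbf{z}) := \int_{(0,1/2]^d} \delta(\mathbf{z},\mathbf{u}) d\mathbf{u}$ satisfies $f(\mathbf{z}) = (\pi^{-r} c(r))^d \, g^c_{\xi,\Lambda,r}(-\mathbf{z})$, where $c(r) = \int_0^{1/2}((1-\cos 2\pi v)/2)^{r/2} dv > 0$, $g^c_{\xi,\Lambda,r}(\mathbf{x}) := \sum_{\mathbf{k}\neq\mathbf{0}} \Lambda(\xi,\mathbf{k}) \prod_{j=1}^d (k_j^c)^{-r} e^{2\pi i(\mathbf{k},\mathbf{x})} + c'^{-rd}(\Lambda(\xi,\mathbf{0}) - 1)$ with $k^c := c'$ if $k = 0$ and $k^c := k$ otherwise, for an appropriate constant $c' = c'(r) > 0$. -/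

import Mathlib

open MeasureTheory Real
open scoped ENNReal

/-- `h^1(x,u)`, the characteristic function of `[-u/2, u/2)`. -/
noncomputable def hOne (u x : ℝ) : ℝ := Set.indicator (Set.Ico (-u / 2) (u / 2)) (fun _ => 1) x

/-- `hIter u n = h^{n+1}(·,u)`: the `(n+1)`-fold self-convolution of `h^1(·,u)`. -/
noncomputable def hIter (u : ℝ) : ℕ → ℝ → ℝ
  | 0 => hOne u
  | n + 1 => fun x => ∫ y : ℝ, hIter u n (x - y) * hOne u y

/-- `perHat u r x = tilde h^r(x, u)`: the 1-periodization of `h^r(·,u)` (for `r ≥ 1`). -/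
noncomputable def perHat (u : ℝ) (r : ℕ) (x : ℝ) : ℝ := ∑' m : ℤ, hIter u (r - 1) (x + m)

/-- The multivariate periodized `r`-smooth hat function
`tilde h^r(x, z, u) = ∏_j tilde h^r(x_j - z_j, u_j)`. -/
noncomputable def perHatD (r : ℕ) {d : ℕ} (z u x : Fin d → ℝ) : ℝ :=
  ∏ j, perHat (u j) r (x j - z j)

/-- The unit cube `[0,1)^d`. -/
def unitCube (d : ℕ) : Set (Fin d → ℝ) := Set.univ.pi fun _ => Set.Ico (0 : ℝ) 1

/-- The cube of shape parameters `(0, 1/2]^d`. -/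
def shapeCube (d : ℕ) : Set (Fin d → ℝ) := Set.univ.pi fun _ => Set.Ioc (0 : ℝ) (1 / 2)

/-- The exponential sum `Λ(ξ, k) = ∑_μ λ_μ e^{2πi (k, ξ^μ)}`. -/
noncomputable def expSum {d m : ℕ} (ξ : Fin m → Fin d → ℝ) (lam : Fin m → ℂ)
    (k : Fin d → ℤ) : ℂ :=
  ∑ μ, lam μ * Complex.exp (2 * π * Complex.I * ∑ j, (k j : ℂ) * (ξ μ j : ℂ))

/-- The error `δ(z,u)` of the cubature formula `(ξ, Λ)` on the periodized
`r`-smooth hat function with shift `z` and shape `u`. -/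
noncomputable def deltaErr (r : ℕ) {d m : ℕ} (ξ : Fin m → Fin d → ℝ) (lam : Fin m → ℂ)
    (z u : Fin d → ℝ) : ℂ :=
  (∑ μ, lam μ * (perHatD r z u (ξ μ) : ℂ)) - ∫ x in unitCube d, (perHatD r z u x : ℂ)

open scoped FourierTransform Convolution

lemma hOne_eq (u : ℝ) : hOne u = Set.indicator (Set.Ico (-u / 2) (u / 2)) (fun _ => (1:ℝ)) := by
  funext x; rfl

lemma hOne_integrable (u : ℝ) : Integrable (hOne u) := by
  rw [hOne_eq]
  exact (integrable_indicator_iff measurableSet_Ico).2 (integrableOn_const (by simp))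

lemma hOne_compact (u : ℝ) : HasCompactSupport (hOne u) := by
  rw [hOne_eq]
  apply HasCompactSupport.intro (isCompact_Icc (a := -u/2) (b := u/2))
  intro x hx
  apply Set.indicator_of_notMem
  intro h; exact hx (Set.Ico_subset_Icc_self h)

lemma hIter_succ_conv (u : ℝ) (n : ℕ) :
    hIter u (n+1) = (hOne u ⋆[ContinuousLinearMap.mul ℝ ℝ] hIter u n) := by
  funext x
  simp only [hIter, convolution, ContinuousLinearMap.mul_apply']
  exact integral_congr_ae (Filter.Eventually.of_forall fun y => mul_comm _ _)

lemma hIter_integrable (u : ℝ) (n : ℕ) : Integrable (hIter u n) := by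
  induction n with
  | zero => exact hOne_integrable u
  | succ n ih => rw [hIter_succ_conv]; exact (hOne_integrable u).integrable_convolution _ ih

lemma hIter_compact (u : ℝ) (n : ℕ) : HasCompactSupport (hIter u n) := by
  induction n with
  | zero => exact hOne_compact u
  | succ n ih => rw [hIter_succ_conv]; exact HasCompactSupport.convolution _ (hOne_compact u) ih

lemma hIter_succ_continuous (u : ℝ) (hu : 0 < u) (n : ℕ) : Continuous (hIter u (n+1)) := by
  have h : hIter u (n+1) = fun x => (∫ t in (0:ℝ)..(x + u/2), hIter u n t) -
      ∫ t in (0:ℝ)..(x - u/2), hIter u n t := by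
    funext x
    have hI := hIter_integrable u n
    rw [intervalIntegral.integral_interval_sub_left hI.intervalIntegrable hI.intervalIntegrable]
    have : hIter u (n+1) x = ∫ y in Set.Ico (-u/2) (u/2), hIter u n (x - y) := by
      simp only [hIter]
      rw [← integral_indicator measurableSet_Ico]
      congr 1; funext y
      simp only [hOne, Set.indicator]
      split_ifs <;> simp
    rw [this, integral_Ico_eq_integral_Ioc, ← intervalIntegral.integral_of_le (by linarith),
      intervalIntegral.integral_comp_sub_left (fun t => hIter u n t) x]
    congr 1 <;> ring
  rw [h]
  have hc := intervalIntegral.continuous_primitive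
    (fun a b => (hIter_integrable u n).intervalIntegrable (a := a) (b := b)) 0
  exact (hc.comp (by fun_prop)).sub (hc.comp (by fun_prop))

/-- normalized sinc -/
noncomputable def snc (u : ℝ) (k : ℤ) : ℂ := if k = 0 then (u:ℂ) else ((Real.sin (π * k * u) / (π * k) : ℝ) : ℂ)

lemma fourier_hOne (u : ℝ) (hu : 0 < u) (k : ℤ) :
    𝓕 (fun x => (hOne u x : ℂ)) (k:ℝ) = snc u k := by
  rw [Real.fourier_real_eq_integral_exp_smul]
  have : (∫ v : ℝ, Complex.exp (↑(-2 * π * v * (k:ℝ)) * Complex.I) • (hOne u v : ℂ))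
      = ∫ v in (-u/2)..(u/2), Complex.exp ((-2 * π * k * Complex.I) * (v:ℂ)) := by
    rw [intervalIntegral.integral_of_le (by linarith), ← integral_Ico_eq_integral_Ioc,
      ← integral_indicator measurableSet_Ico]
    congr 1; funext y
    simp only [hOne, Set.indicator]
    split_ifs
    · simp only [Complex.ofReal_one, smul_eq_mul, mul_one]; congr 1; push_cast; ring
    · simp
  rw [this]
  unfold snc
  split_ifs with hk
  · subst hk; simp; ring
  · have hk' : (k:ℂ) ≠ 0 := by exact_mod_cast hk
    have hpi : (π:ℂ) ≠ 0 := by exact_mod_cast Real.pi_ne_zero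
    rw [integral_exp_mul_complex (by simp [hk', hpi])]
    push_cast
    rw [Complex.sin]
    have e1 : (-2 * π * k * Complex.I) * ((u:ℂ)/2) = -(π * k * u) * Complex.I := by ring
    have e2 : (-2 * π * k * Complex.I) * ((-u:ℂ)/2) = (π * k * u) * Complex.I := by ring
    rw [e1, e2]
    field_simp
    rw [Complex.I_sq]
    ring_nf

lemma fourier_hIter (u : ℝ) (hu : 0 < u) (n : ℕ) (k : ℤ) :
    𝓕 (fun x => (hIter u n x : ℂ)) (k:ℝ) = snc u k ^ (n+1) := by
  induction n with
  | zero => simpa [hIter] using fourier_hOne u hu k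
  | succ n ih =>
    have : (fun x => (hIter u (n+1) x : ℂ)) =
        ((fun x => (hOne u x : ℂ)) ⋆[ContinuousLinearMap.mul ℂ ℂ] (fun x => (hIter u n x : ℂ))) := by
      funext x
      rw [hIter_succ_conv]
      simp only [convolution, ContinuousLinearMap.mul_apply']
      rw [← integral_complex_ofReal]
      simp
    have h1 : Integrable (fun x => (hOne u x : ℂ)) := (hOne_integrable u).ofReal
    have h2 : Integrable (fun x => (hIter u n x : ℂ)) := (hIter_integrable u n).ofReal
    rw [this, Real.fourier_mul_convolution_eq (R := ℂ) h1 h2,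
      ih, fourier_hOne u hu, pow_succ' _ (n+1)]

/-- dominating sequence -/
noncomputable def bd (k : ℤ) : ℝ := 1 / (k:ℝ)^2 + if k = 0 then 1 else 0

lemma bd_summable : Summable bd :=
  (Real.summable_one_div_int_pow.2 one_lt_two).add (hasSum_ite_eq 0 1).summable

lemma snc_bound (u : ℝ) (hu : 0 ≤ u) (hu' : u ≤ 1) (r : ℕ) (hr : 2 ≤ r) (k : ℤ) :
    ‖snc u k ^ r‖ ≤ bd k := by
  unfold snc bd
  rw [norm_pow]
  split_ifs with hk
  · subst hk; simp [abs_of_nonneg hu]; exact pow_le_one₀ hu hu'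
  · rw [Complex.norm_real, Real.norm_eq_abs, abs_div, abs_mul, abs_of_pos Real.pi_pos, add_zero]
    have hk1 : (1:ℝ) ≤ |(k:ℝ)| := by exact_mod_cast Int.one_le_abs hk
    have h0 : |Real.sin (π * k * u)| / (π * |(k:ℝ)|) ≤ 1 / |(k:ℝ)| := by
      apply div_le_div₀ zero_le_one (Real.abs_sin_le_one _) (by linarith)
      nlinarith [Real.pi_gt_three]
    calc _ ≤ (1 / |(k:ℝ)|)^r := by gcongr
      _ ≤ (1 / |(k:ℝ)|)^2 := by
        apply pow_le_pow_of_le_one (by positivity) _ hr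
        rw [div_le_one (by linarith)]; exact hk1
      _ = _ := by rw [div_pow, one_pow, sq_abs]

/-- character -/
noncomputable def ch (k : ℤ) (x : ℝ) : ℂ := Complex.exp (2 * π * Complex.I * (k * x))

lemma ch_norm (k : ℤ) (x : ℝ) : ‖ch k x‖ = 1 := by
  unfold ch
  have : (2 * π * Complex.I * (k * x) : ℂ) = ((2 * π * k * x : ℝ) : ℂ) * Complex.I := by
    push_cast; ring
  rw [this, Complex.norm_exp_ofReal_mul_I]

lemma term_bound (u : ℝ) (hu : 0 ≤ u) (hu' : u ≤ 1) (r : ℕ) (hr : 2 ≤ r) (k : ℤ) (x : ℝ) :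
    ‖snc u k ^ r * ch k x‖ ≤ bd k := by
  rw [norm_mul, ch_norm, mul_one]; exact snc_bound u hu hu' r hr k

lemma perHat_hasSum (u : ℝ) (hu : 0 < u) (hu' : u ≤ 1) (r : ℕ) (hr : 2 ≤ r) (x : ℝ) :
    HasSum (fun k : ℤ => snc u k ^ r * ch k x) (perHat u r x : ℂ) := by
  obtain ⟨n, rfl⟩ : ∃ n, r = n + 2 := ⟨r - 2, by omega⟩
  have hs : Summable (fun k : ℤ => snc u k ^ (n+2) * ch k x) :=
    Summable.of_norm_bounded bd_summable (fun k => term_bound u hu.le hu' _ hr k x)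
  have hs' : Summable (fun k : ℤ => snc u k ^ (n+2)) :=
    Summable.of_norm_bounded bd_summable (fun k => snc_bound u hu.le hu' _ hr k)
  convert hs.hasSum using 1
  have hc : Continuous (fun x => (hIter u (n+1) x : ℂ)) :=
    Complex.continuous_ofReal.comp (hIter_succ_continuous u hu n)
  have hcs : HasCompactSupport (fun x => (hIter u (n+1) x : ℂ)) :=
    (hIter_compact u (n+1)).comp_left (g := fun x : ℝ => (x:ℂ)) (by simp)
  have key := Real.tsum_eq_tsum_fourier_of_rpow_decay_of_summable hc (b := 2) one_lt_two
    (Filter.EventuallyEq.trans_isBigO (hasCompactSupport_iff_eventuallyEq.1 hcs |>.filter_mono Filter.cocompact_le_coclosedCompact)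
      (Asymptotics.isBigO_zero _ _)) (by simpa only [fourier_hIter u hu] using hs') x
  simp only [fourier_hIter u hu] at key
  unfold perHat
  rw [Complex.ofReal_tsum]
  simp only [show n + 2 - 1 = n + 1 by omega]
  rw [key]
  congr 1; funext k
  congr 1
  rw [fourier_coe_apply]
  unfold ch; congr 1; push_cast; ring

/-- averaged coefficients -/
noncomputable def av (r : ℕ) (k : ℤ) : ℂ := ∫ u in Set.Ioc (0:ℝ) (1/2), snc u k ^ r

lemma snc_continuous (k : ℤ) : Continuous (fun u => snc u k) := by
  unfold snc
  split_ifs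
  · exact Complex.continuous_ofReal
  · fun_prop

lemma av_norm (r : ℕ) (hr : 2 ≤ r) (k : ℤ) : ‖av r k‖ ≤ bd k := by
  have h := norm_setIntegral_le_of_norm_le_const (μ := volume) (s := Set.Ioc (0:ℝ) (1/2))
    (f := fun u => snc u k ^ r) (C := bd k) (by simp)
    (fun u hu => snc_bound u hu.1.le (by linarith [hu.2]) r hr k)
  have hb : 0 ≤ bd k := (norm_nonneg _).trans (snc_bound 0 le_rfl zero_le_one r hr k)
  refine h.trans ?_
  simp
  linarith

lemma perHat_integrableOn (r : ℕ) (hr : 2 ≤ r) (x : ℝ) :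
    IntegrableOn (fun u => (perHat u r x : ℂ)) (Set.Ioc (0:ℝ) (1/2)) := by
  have hc : ContinuousOn (fun u => ∑' k : ℤ, snc u k ^ r * ch k x) (Set.Icc (0:ℝ) (1/2)) := by
    apply continuousOn_tsum (u := bd)
    · intro k
      exact (((snc_continuous k).pow r).mul continuous_const).continuousOn
    · exact bd_summable
    · intro k u hu
      exact term_bound u hu.1 (by linarith [hu.2]) r hr k x
  have h1 := (hc.integrableOn_compact (μ := volume) isCompact_Icc).mono_set Set.Ioc_subset_Icc_self
  refine h1.congr_fun (fun u hu => ?_) measurableSet_Ioc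
  exact (perHat_hasSum u hu.1 (by linarith [hu.2]) r hr x).tsum_eq

lemma integral_hasSum (r : ℕ) (hr : 2 ≤ r) (x : ℝ) :
    HasSum (fun k : ℤ => av r k * ch k x) (∫ u in Set.Ioc (0:ℝ) (1/2), (perHat u r x : ℂ)) := by
  have hfin : IsFiniteMeasure (volume.restrict (Set.Ioc (0:ℝ) (1/2))) := ⟨by simp⟩
  have h := hasSum_integral_of_dominated_convergence (μ := volume.restrict (Set.Ioc (0:ℝ) (1/2)))
    (F := fun (k : ℤ) u => snc u k ^ r * ch k x) (f := fun u => (perHat u r x : ℂ))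
    (fun k _ => bd k)
    (fun k => (((snc_continuous k).pow r).mul continuous_const).aestronglyMeasurable)
    (fun k => (ae_restrict_iff' measurableSet_Ioc).2 (Filter.Eventually.of_forall
      fun u hu => term_bound u hu.1.le (by linarith [hu.2]) r hr k x))
    (Filter.Eventually.of_forall fun _ => bd_summable)
    (integrable_const _)
    ((ae_restrict_iff' measurableSet_Ioc).2 (Filter.Eventually.of_forall
      fun u hu => perHat_hasSum u hu.1 (by linarith [hu.2]) r hr x))
  simp only [integral_mul_const] at h
  exact h

lemma ch_integral (k : ℤ) (z : ℝ) : ∫ x in Set.Ico (0:ℝ) 1, ch k (x - z) = if k = 0 then 1 else 0 := by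
  rw [integral_Ico_eq_integral_Ioc, ← intervalIntegral.integral_of_le zero_le_one]
  split_ifs with hk
  · subst hk; simp [ch]
  · have hk' : (k:ℂ) ≠ 0 := by exact_mod_cast hk
    have hpi : (π:ℂ) ≠ 0 := by exact_mod_cast Real.pi_ne_zero
    have : ∀ x : ℝ, ch k (x - z) = Complex.exp ((2 * π * Complex.I * k) * (x:ℂ)) * ch k (-z) := by
      intro x
      unfold ch; rw [← Complex.exp_add]; congr 1; push_cast; ring
    simp only [this]
    rw [intervalIntegral.integral_mul_const, integral_exp_mul_complex (by simp [hk', hpi])]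
    have e : Complex.exp (2 * π * Complex.I * k * (1:ℝ)) = 1 := by
      rw [Complex.exp_eq_one_iff]; exact ⟨k, by push_cast; ring⟩
    rw [e]; simp

lemma ch_continuous (k : ℤ) : Continuous (ch k) := by unfold ch; fun_prop

lemma perHat_integral (u : ℝ) (hu : 0 < u) (hu' : u ≤ 1) (r : ℕ) (hr : 2 ≤ r) (z : ℝ) :
    ∫ x in Set.Ico (0:ℝ) 1, (perHat u r (x - z) : ℂ) = (u:ℂ)^r := by
  have hfin : IsFiniteMeasure (volume.restrict (Set.Ico (0:ℝ) 1)) := ⟨by simp⟩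
  have h := hasSum_integral_of_dominated_convergence (μ := volume.restrict (Set.Ico (0:ℝ) 1))
    (F := fun (k : ℤ) x => snc u k ^ r * ch k (x - z)) (f := fun x => (perHat u r (x - z) : ℂ))
    (fun k _ => bd k)
    (fun k => (continuous_const.mul ((ch_continuous k).comp (continuous_sub_right z))).aestronglyMeasurable)
    (fun k => (Filter.Eventually.of_forall
      fun x => term_bound u hu.le hu' r hr k _))
    (Filter.Eventually.of_forall fun _ => bd_summable)
    (integrable_const _)
    ((Filter.Eventually.of_forall
      fun x => perHat_hasSum u hu hu' r hr _))
  simp only [integral_const_mul, ch_integral] at h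
  have h2 := hasSum_single (f := fun k : ℤ => snc u k ^ r * (if k = 0 then (1:ℂ) else 0)) 0
    (by intro k hk; simp [hk])
  rw [h.unique h2]; simp [snc]

lemma sin_pow_integral (r : ℕ) (hre : Even r) (k : ℤ) (hk : k ≠ 0) :
    ∫ u in (0:ℝ)..(1/2), Real.sin (π * k * u)^r = ∫ v in (0:ℝ)..(1/2), Real.sin (π * v)^r := by
  have hkr : (k:ℝ) ≠ 0 := by exact_mod_cast hk
  set f : ℝ → ℝ := fun v => Real.sin (π * v)^r with hf
  have hfc : Continuous f := by fun_prop
  have hper : Function.Periodic f 1 := by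
    intro x
    simp only [hf]
    rw [mul_add, mul_one, Real.sin_add_pi, hre.neg_pow]
  have hev : ∀ a : ℝ, ∫ x in (-a)..a, f x = 2 * ∫ x in (0:ℝ)..a, f x := by
    intro a
    rw [← intervalIntegral.integral_add_adjacent_intervals (b := 0)
      (hfc.intervalIntegrable _ _) (hfc.intervalIntegrable _ _)]
    have h1 := intervalIntegral.integral_comp_neg (a := 0) (b := a) f
    have h2 : ∀ x, f (-x) = f x := by
      intro x; simp only [hf]; rw [mul_neg, Real.sin_neg, hre.neg_pow]
    simp only [h2, neg_zero] at h1
    rw [← h1]; ring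
  have h1 : ∫ u in (0:ℝ)..(1/2), Real.sin (π * k * u)^r = (k:ℝ)⁻¹ * ∫ v in (0:ℝ)..(k/2), f v := by
    have := intervalIntegral.integral_comp_mul_left (a := 0) (b := 1/2) f hkr
    simp only [hf, ← mul_assoc, mul_zero, smul_eq_mul] at this
    rw [this]; simp only [hf]; congr 2; ring
  have h2 := hper.intervalIntegral_add_zsmul_eq k (-(k/2:ℝ)) (fun _ _ => hfc.intervalIntegrable _ _)
  have h3 := hper.intervalIntegral_add_eq (-(k/2:ℝ)) (-(1/2))
  rw [h3] at h2
  have e1 : -(k/2:ℝ) + k • (1:ℝ) = k/2 := by simp; ring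
  have e2 : -(1/2:ℝ) + 1 = 1/2 := by norm_num
  rw [e1, e2, hev, hev, zsmul_eq_mul] at h2
  rw [h1]
  field_simp
  linarith

lemma cr_eq (r : ℕ) (hre : Even r) :
    (∫ v in (0 : ℝ)..(1 / 2), ((1 - Real.cos (2 * π * v)) / 2) ^ ((r : ℝ) / 2)) =
      ∫ v in (0:ℝ)..(1/2), Real.sin (π * v)^r := by
  obtain ⟨s, rfl⟩ := hre
  congr 1; funext v
  have : (1 - Real.cos (2 * π * v)) / 2 = Real.sin (π * v)^2 := by
    rw [mul_assoc, Real.cos_two_mul, Real.sin_sq]; ring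
  rw [this, show ((s + s : ℕ) : ℝ) / 2 = (s:ℝ) by push_cast; ring, Real.rpow_natCast, ← pow_mul]
  congr 1; ring

lemma cr_pos (r : ℕ) : 0 < ∫ v in (0:ℝ)..(1/2), Real.sin (π * v)^r := by
  apply intervalIntegral.intervalIntegral_pos_of_pos_on
  · exact Continuous.intervalIntegrable (by fun_prop) _ _
  · intro x hx
    apply pow_pos
    apply Real.sin_pos_of_pos_of_lt_pi
    · exact mul_pos Real.pi_pos hx.1
    · nlinarith [Real.pi_pos, hx.2]
  · norm_num

lemma av_zero (r : ℕ) : av r 0 = (((1/2)^(r+1) / (r+1) : ℝ) : ℂ) := by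
  unfold av
  rw [← intervalIntegral.integral_of_le (by norm_num)]
  simp only [snc, if_true]
  have : ∀ u : ℝ, (u:ℂ)^r = ((u^r : ℝ) : ℂ) := by intro u; push_cast; rfl
  simp only [this]
  rw [intervalIntegral.integral_ofReal, integral_pow]
  simp

lemma av_ne (r : ℕ) (hre : Even r) (k : ℤ) (hk : k ≠ 0) : av r k =
    ((π:ℂ)^(-(r:ℤ)) * ((∫ v in (0:ℝ)..(1/2), Real.sin (π * v)^r : ℝ) : ℂ)) * (k:ℂ)^(-(r:ℤ)) := by
  unfold av
  rw [← intervalIntegral.integral_of_le (by norm_num)]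
  simp only [snc, if_neg hk]
  have : ∀ u : ℝ, ((Real.sin (π * k * u) / (π * k) : ℝ) : ℂ)^r =
    ((Real.sin (π * k * u)^r * ((π * k)^r)⁻¹ : ℝ) : ℂ) := by
      intro u; push_cast; rw [div_pow]; rfl
  simp only [this]
  rw [intervalIntegral.integral_ofReal, intervalIntegral.integral_mul_const,
    sin_pow_integral r hre k hk]
  push_cast
  rw [zpow_neg, zpow_neg, zpow_natCast, zpow_natCast, mul_pow, mul_inv]
  ring

lemma prod_hasSum (d : ℕ) (f : Fin d → ℤ → ℂ) (hf : ∀ j, Summable (fun k => ‖f j k‖)) :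
    Summable (fun k : Fin d → ℤ => ‖∏ j, f j (k j)‖) ∧
    HasSum (fun k : Fin d → ℤ => ∏ j, f j (k j)) (∏ j, ∑' k, f j k) := by
  induction d with
  | zero =>
    constructor
    · exact (hasSum_fintype _).summable
    · convert hasSum_fintype (fun k : Fin 0 → ℤ => ∏ j, f j (k j)) using 1
      simp
  | succ d ih =>
    obtain ⟨h1, h2⟩ := ih (fun j => f j.succ) (fun j => hf j.succ)
    let e : ℤ × (Fin d → ℤ) ≃ (Fin (d+1) → ℤ) := Fin.consEquiv (fun _ => ℤ)
    have he : ∀ p, ∏ j, f j (e p j) = f 0 p.1 * ∏ j : Fin d, f j.succ (p.2 j) := by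
      intro p
      rw [Fin.prod_univ_succ]
      simp [e, Fin.consEquiv]
    have hs := (hf 0).mul_norm h1
    constructor
    · rw [← e.summable_iff]
      refine hs.congr ?_
      intro p; simp only [Function.comp, he]
    · rw [← e.hasSum_iff, Fin.prod_univ_succ]
      have := (hf 0).of_norm.hasSum.mul h2 hs.of_norm
      have hfun : ((fun k : Fin (d+1) → ℤ => ∏ j, f j (k j)) ∘ e) =
          fun p => f 0 p.1 * ∏ j : Fin d, f j.succ (p.2 j) := by
        funext p; simp only [Function.comp, he]
      rw [hfun]
      exact this

lemma shape_restrict (d : ℕ) : (volume : Measure (Fin d → ℝ)).restrict (shapeCube d) =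
    Measure.pi fun _ => volume.restrict (Set.Ioc (0:ℝ) (1/2)) := by
  rw [shapeCube, volume_pi, Measure.restrict_pi_pi]

lemma unit_restrict (d : ℕ) : (volume : Measure (Fin d → ℝ)).restrict (unitCube d) =
    Measure.pi fun _ => volume.restrict (Set.Ico (0:ℝ) 1) := by
  rw [unitCube, volume_pi, Measure.restrict_pi_pi]

lemma delta_integral (r d m : ℕ) (hr : 2 ≤ r) (ξ : Fin m → Fin d → ℝ) (lam : Fin m → ℂ)
    (z : Fin d → ℝ) : (∫ u in shapeCube d, deltaErr r ξ lam z u) =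
    (∑ μ, lam μ * ∏ j, ∫ u in Set.Ioc (0:ℝ) (1/2), (perHat u r (ξ μ j - z j) : ℂ)) - av r 0 ^ d := by
  have hms : MeasurableSet (shapeCube d) := MeasurableSet.univ_pi fun _ => measurableSet_Ioc
  have h1 : (∫ u in shapeCube d, deltaErr r ξ lam z u) = ∫ u in shapeCube d,
      ((∑ μ, lam μ * ∏ j, (perHat (u j) r (ξ μ j - z j) : ℂ)) - ∏ j, snc (u j) 0 ^ r) := by
    apply setIntegral_congr_fun hms
    intro u hu
    have hu' : ∀ j, 0 < u j ∧ u j ≤ 1/2 := fun j => hu j trivial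
    simp only [deltaErr, perHatD, Complex.ofReal_prod]
    congr 1
    rw [unit_restrict, integral_fintype_prod_eq_prod (fun j (x : ℝ) => (perHat (u j) r (x - z j) : ℂ))]
    apply Finset.prod_congr rfl
    intro j _
    rw [perHat_integral (u j) (hu' j).1 (by linarith [(hu' j).2]) r hr]
    simp [snc]
  rw [h1, shape_restrict]
  have hi1 : ∀ μ, Integrable (fun u : Fin d → ℝ => lam μ * ∏ j, (perHat (u j) r (ξ μ j - z j) : ℂ))
      (Measure.pi fun _ => volume.restrict (Set.Ioc (0:ℝ) (1/2))) := by
    intro μ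
    exact (Integrable.fintype_prod (f := fun j (u : ℝ) => (perHat u r (ξ μ j - z j) : ℂ))
      (fun j => perHat_integrableOn r hr _)).const_mul _
  have hi2 : Integrable (fun u : Fin d → ℝ => ∏ j, snc (u j) 0 ^ r)
      (Measure.pi fun _ => volume.restrict (Set.Ioc (0:ℝ) (1/2))) := by
    apply Integrable.fintype_prod (f := fun (j : Fin d) (u : ℝ) => snc u 0 ^ r)
    intro j
    exact (((snc_continuous 0).pow r).integrableOn_Icc (a := 0) (b := 1/2)).mono_set
      Set.Ioc_subset_Icc_self
  rw [integral_sub (integrable_finsetSum _ fun μ _ => hi1 μ) hi2,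
    integral_finsetSum _ fun μ _ => hi1 μ]
  congr 1
  · apply Finset.sum_congr rfl
    intro μ _
    rw [integral_const_mul,
      integral_fintype_prod_eq_prod (fun j (u : ℝ) => (perHat u r (ξ μ j - z j) : ℂ))]
  · rw [integral_fintype_prod_eq_prod (fun (j : Fin d) (u : ℝ) => snc u 0 ^ r)]
    simp [av]

lemma ch_prod {d : ℕ} (k : Fin d → ℤ) (x z : Fin d → ℝ) :
    ∏ j, ch (k j) (x j - z j) = Complex.exp (2 * π * Complex.I * ∑ j, (k j : ℂ) * (x j : ℂ)) *
      Complex.exp (2 * π * Complex.I * ∑ j, (k j : ℂ) * ((-z) j : ℂ)) := by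
  unfold ch
  rw [← Complex.exp_sum, ← Complex.exp_add, ← mul_add, ← Finset.sum_add_distrib, Finset.mul_sum]
  congr 1
  apply Finset.sum_congr rfl
  intro j _
  simp only [Pi.neg_apply]; push_cast; ring

/-- For even `r`, the `u`-averaged error function
`f(z) = ∫_{(0,1/2]^d} δ(z,u) du` satisfies `f(z) = (π^{-r} c(r))^d g^{c'}_{ξ,Λ,r}(-z)`,
where `c(r) = ∫_0^{1/2} ((1 - cos 2πv)/2)^{r/2} dv > 0`,
`g^{c'}_{ξ,Λ,r}(x) = ∑_{k≠0} Λ(ξ,k) ∏_j (k_j^{c'})^{-r} e^{2πi(k,x)} + c'^{-rd}(Λ(ξ,0)-1)`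
with `k^{c'} = c'` for `k = 0` and `k^{c'} = k` otherwise, for a suitable `c' = c'(r) > 0`. -/
theorem stmt18 (r d m : ℕ) (hr : 1 ≤ r) (hre : Even r) (hd : 1 ≤ d)
    (ξ : Fin m → Fin d → ℝ) (hξ : ∀ μ, ξ μ ∈ unitCube d) (lam : Fin m → ℂ) :
    0 < (∫ v in (0 : ℝ)..(1 / 2), ((1 - Real.cos (2 * π * v)) / 2) ^ ((r : ℝ) / 2)) ∧
    ∃ c' : ℝ, 0 < c' ∧ ∀ z : Fin d → ℝ,
      (∫ u in shapeCube d, deltaErr r ξ lam z u)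
        = (((π : ℂ) ^ (-(r : ℤ)) *
              ((∫ v in (0 : ℝ)..(1 / 2), ((1 - Real.cos (2 * π * v)) / 2) ^ ((r : ℝ) / 2) : ℝ) : ℂ)) ^ d) *
          ((∑' k : Fin d → ℤ,
              if k = 0 then 0
              else expSum ξ lam k *
                (∏ j, (if k j = 0 then (c' : ℂ) else (k j : ℂ)) ^ (-(r : ℤ))) *
                Complex.exp (2 * π * Complex.I * ∑ j, (k j : ℂ) * ((-z) j : ℂ)))
            + (c' : ℂ) ^ (-((r * d : ℕ) : ℤ)) * (expSum ξ lam 0 - 1)) := by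
  have hr2 : 2 ≤ r := by
    obtain ⟨s, rfl⟩ := hre
    omega
  rw [cr_eq r hre]
  have hc := cr_pos r
  set c := ∫ v in (0:ℝ)..(1/2), Real.sin (π * v)^r with hcdef
  refine ⟨hc, ?_⟩
  set a : ℝ := (1/2)^(r+1) / (r+1) with ha
  have hapos : 0 < a := by positivity
  have hq : 0 < (π^r)⁻¹ * c / a := by positivity
  refine ⟨((π^r)⁻¹ * c / a) ^ ((r:ℝ)⁻¹), Real.rpow_pos_of_pos hq _, fun z => ?_⟩
  set c' : ℝ := ((π^r)⁻¹ * c / a) ^ ((r:ℝ)⁻¹) with hc'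
  have hc'pow : c' ^ r = (π^r)⁻¹ * c / a := Real.rpow_inv_natCast_pow hq.le (by omega)
  set K : ℂ := (π:ℂ)^(-(r:ℤ)) * (c:ℂ) with hK
  have hK0 : K * (c':ℂ)^(-(r:ℤ)) = av r 0 := by
    rw [av_zero, hK, zpow_neg, zpow_neg, zpow_natCast, zpow_natCast, ← ha, ← Complex.ofReal_pow c',
      hc'pow]
    norm_cast
    have := Real.pi_pos
    field_simp
  have hKk : ∀ k : ℤ, K * (if k = 0 then (c':ℂ) else (k:ℂ))^(-(r:ℤ)) = av r k := by
    intro k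
    split_ifs with hk
    · rw [hk]; exact hK0
    · rw [av_ne r hre k hk]
  have hprod : ∀ k : Fin d → ℤ, K^d * ∏ j, (if k j = 0 then (c':ℂ) else (k j:ℂ))^(-(r:ℤ)) =
      ∏ j, av r (k j) := by
    intro k
    rw [← Finset.prod_congr rfl (fun j _ => hKk (k j)), Finset.prod_mul_distrib]
    simp
  have hpow : K^d * (c':ℂ)^(-((r * d : ℕ) : ℤ)) = av r 0 ^ d := by
    have e : (c':ℂ)^(-((r * d : ℕ) : ℤ)) = ((c':ℂ)^(-(r:ℤ)))^d := by
      rw [zpow_neg, zpow_neg, zpow_natCast, zpow_natCast, pow_mul, inv_pow]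
    rw [e, ← hK0, ← mul_pow K]
  rw [delta_integral r d m hr2]
  have hsum : ∀ μ, HasSum (fun k : Fin d → ℤ => ∏ j, (av r (k j) * ch (k j) (ξ μ j - z j)))
      (∏ j, ∫ u in Set.Ioc (0:ℝ) (1/2), (perHat u r (ξ μ j - z j) : ℂ)) := by
    intro μ
    have h := (prod_hasSum d (fun j k => av r k * ch k (ξ μ j - z j)) (fun j => by
      refine Summable.of_nonneg_of_le (fun _ => norm_nonneg _) (fun k => ?_) bd_summable
      rw [norm_mul, ch_norm, mul_one]; exact av_norm r hr2 k)).2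
    simpa only [(integral_hasSum r hr2 _).tsum_eq] using h
  have hT := hasSum_sum (s := Finset.univ) (fun μ _ => (hsum μ).mul_left (lam μ))
  have hTeq : ∀ k : Fin d → ℤ, ∑ μ, lam μ * ∏ j, (av r (k j) * ch (k j) (ξ μ j - z j)) =
      K^d * (expSum ξ lam k * (∏ j, (if k j = 0 then (c' : ℂ) else (k j : ℂ)) ^ (-(r : ℤ))) *
        Complex.exp (2 * π * Complex.I * ∑ j, (k j : ℂ) * ((-z) j : ℂ))) := by
    intro k
    have e : ∀ A B C D : ℂ, A * (B * C * D) = B * ((A * C) * D) := by intros; ring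
    rw [e, hprod, expSum, Finset.sum_mul]
    apply Finset.sum_congr rfl
    intro μ _
    rw [Finset.prod_mul_distrib, ch_prod]
    ring
  simp only [hTeq] at hT
  have h0 := hT.sub (hasSum_ite_eq (0 : Fin d → ℤ) (expSum ξ lam 0 * av r 0 ^ d))
  have hfun : (fun k : Fin d → ℤ => K^d * (expSum ξ lam k *
        (∏ j, (if k j = 0 then (c' : ℂ) else (k j : ℂ)) ^ (-(r : ℤ))) *
        Complex.exp (2 * π * Complex.I * ∑ j, (k j : ℂ) * ((-z) j : ℂ))) -
        if k = 0 then expSum ξ lam 0 * av r 0 ^ d else 0) =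
      fun k => K^d * (if k = 0 then 0 else expSum ξ lam k *
        (∏ j, (if k j = 0 then (c' : ℂ) else (k j : ℂ)) ^ (-(r : ℤ))) *
        Complex.exp (2 * π * Complex.I * ∑ j, (k j : ℂ) * ((-z) j : ℂ))) := by
    funext k
    split_ifs with hk
    · subst hk
      have := hprod 0
      simp only [Pi.zero_apply, Finset.prod_const, Finset.card_univ, Fintype.card_fin] at this
      simp only [Pi.zero_apply, Finset.prod_const, Finset.card_univ, Fintype.card_fin,
        Int.cast_zero, zero_mul, Finset.sum_const_zero, mul_zero, Complex.exp_zero, mul_one]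
      rw [← this]; ring
    · simp
  rw [hfun] at h0
  rw [mul_add, ← tsum_mul_left, h0.tsum_eq, ← mul_assoc, hpow]
  ring
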